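/- Let K be a field, (A,▷,◁) a finite-dimensional special apre-perm algebra over K, and B a nondegenerate bilinear form on A. Then (A,▷,◁,B) is a quadratic special apre-perm algebra (i.e. B is symmetric and B(x◁y,z) = −B(x,z∘y) for all x,y,z) if and only if the 2-tensor φ_B is symmetric and f(x)(φ_B) = 0 for all x ∈ A. Moreover, in this case also g(x)(φ_B) = 0 for all x ∈ A, so φ_B is invariant on (A,▷,◁). -/

import Mathlib

open TensorProduct

noncomputable section

namespace Paper

variable {K : Type*} [Field K]

section Defs

variable {A : Type*} [AddCommGroup A] [Module K A]
variable {V : Type*} [AddCommGroup V] [Module K V]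

/-- Commutativity of a bilinear multiplication. -/
def IsComm (m : A →ₗ[K] A →ₗ[K] A) : Prop := ∀ x y, m x y = m y x

/-- Associativity of a bilinear multiplication. -/
def IsAssoc (m : A →ₗ[K] A →ₗ[K] A) : Prop := ∀ x y z, m (m x y) z = m x (m y z)

/-- `P` is an averaging operator on `(A, m)`. -/
def IsAveragingOp (m : A →ₗ[K] A →ₗ[K] A) (P : A →ₗ[K] A) : Prop :=
  ∀ x y, m (P x) (P y) = P (m (P x) y) ∧ P (m (P x) y) = P (m x (P y))

/-- `(A, m, P, Q)` is an admissible averaging commutative algebra. -/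
def IsAdmissibleAveraging (m : A →ₗ[K] A →ₗ[K] A) (P Q : A →ₗ[K] A) : Prop :=
  IsComm m ∧ IsAssoc m ∧ IsAveragingOp m P ∧
    ∀ x y, m (P x) (Q y) = Q (m (P x) y) ∧ Q (m (P x) y) = Q (m x (Q y))

/-- The flip `τ` on `A ⊗ A`. -/
def tau (r : A ⊗[K] A) : A ⊗[K] A := TensorProduct.comm K A A r

/-- The linear map `A* → A`, `a* ↦ r♯(a*)`, associated with `r ∈ A ⊗ A`,
determined by `⟨r♯(a*), b*⟩ = ⟨r, a* ⊗ b*⟩`. -/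
def sharp (r : A ⊗[K] A) : Module.Dual K A →ₗ[K] A :=
  (TensorProduct.lid K A).toLinearMap ∘ₗ LinearMap.applyₗ r ∘ₗ LinearMap.rTensorHom A

/-- `s ∈ A ⊗ A` is invariant on `(A, m)`:  `(id ⊗ L(x) - L(x) ⊗ id) s = 0` for all `x`. -/
def IsInvariant (m : A →ₗ[K] A →ₗ[K] A) (s : A ⊗[K] A) : Prop :=
  ∀ x : A, LinearMap.lTensor A (m x) s = LinearMap.rTensor A (m x) s

/-- `(u⊗v)⊗(u'⊗v') ↦ b(u⊗u') ⊗ v ⊗ v'`. -/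
def place1 (b : A ⊗[K] A →ₗ[K] A) :
    (A ⊗[K] A) ⊗[K] (A ⊗[K] A) →ₗ[K] A ⊗[K] (A ⊗[K] A) :=
  LinearMap.rTensor (A ⊗[K] A) b ∘ₗ (TensorProduct.tensorTensorTensorComm K A A A A).toLinearMap

/-- `(u⊗v)⊗(u'⊗v') ↦ u ⊗ b(v⊗u') ⊗ v'`. -/
def place2 (b : A ⊗[K] A →ₗ[K] A) :
    (A ⊗[K] A) ⊗[K] (A ⊗[K] A) →ₗ[K] A ⊗[K] (A ⊗[K] A) :=
  LinearMap.lTensor A (LinearMap.rTensor A b) ∘ₗ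
    LinearMap.lTensor A (TensorProduct.assoc K A A A).symm.toLinearMap ∘ₗ
      (TensorProduct.assoc K A A (A ⊗[K] A)).toLinearMap

/-- `(u⊗v)⊗(u'⊗v') ↦ u ⊗ u' ⊗ b(v⊗v')`. -/
def place3 (b : A ⊗[K] A →ₗ[K] A) :
    (A ⊗[K] A) ⊗[K] (A ⊗[K] A) →ₗ[K] A ⊗[K] (A ⊗[K] A) :=
  (TensorProduct.assoc K A A A).toLinearMap ∘ₗ LinearMap.lTensor (A ⊗[K] A) b ∘ₗ
    (TensorProduct.tensorTensorTensorComm K A A A A).toLinearMap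

/-- A bilinear multiplication as a linear map on the tensor square. -/
def liftM (m : A →ₗ[K] A →ₗ[K] A) : A ⊗[K] A →ₗ[K] A := TensorProduct.lift m

/-- The opposite multiplication as a linear map on the tensor square: `u ⊗ v ↦ m v u`. -/
def flipM (m : A →ₗ[K] A →ₗ[K] A) : A ⊗[K] A →ₗ[K] A :=
  TensorProduct.lift m ∘ₗ (TensorProduct.comm K A A).toLinearMap

/-- For `r = Σᵢ uᵢ ⊗ vᵢ`, the element
`𝐀(r) = Σᵢⱼ (uᵢ·uⱼ)⊗vᵢ⊗vⱼ − uᵢ⊗(uⱼ·vᵢ)⊗vⱼ + uᵢ⊗uⱼ⊗(vᵢ·vⱼ)` of `A⊗A⊗A`. -/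
def Acal (m : A →ₗ[K] A →ₗ[K] A) (r : A ⊗[K] A) : A ⊗[K] (A ⊗[K] A) :=
  place1 (liftM m) (r ⊗ₜ[K] r) - place2 (flipM m) (r ⊗ₜ[K] r) + place3 (liftM m) (r ⊗ₜ[K] r)

/-- `r` is a solution of the averaging associative Yang–Baxter equation (AAYBE) in
`(A, m, P, Q)`: `𝐀(r) = 0`, `(P⊗id − id⊗Q)(r) = 0` and `(Q⊗id − id⊗P)(r) = 0`. -/
def IsAAYBESolution (m : A →ₗ[K] A →ₗ[K] A) (P Q : A →ₗ[K] A) (r : A ⊗[K] A) : Prop :=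
  Acal m r = 0 ∧ LinearMap.rTensor A P r = LinearMap.lTensor A Q r ∧
    LinearMap.rTensor A Q r = LinearMap.lTensor A P r

/-- The co-multiplication `Δ_r : x ↦ (id ⊗ L(x) − L(x) ⊗ id)(r)`. -/
def DeltaMap (m : A →ₗ[K] A →ₗ[K] A) (r : A ⊗[K] A) : A →ₗ[K] A ⊗[K] A :=
  (LinearMap.applyₗ r ∘ₗ LinearMap.lTensorHom A) ∘ₗ m -
    (LinearMap.applyₗ r ∘ₗ LinearMap.rTensorHom A) ∘ₗ m

/-- The dual representation map `x ↦ (ρ(x))*`. -/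
def dualRep (ρ : A →ₗ[K] V →ₗ[K] V) : A →ₗ[K] Module.Dual K V →ₗ[K] Module.Dual K V :=
  Module.Dual.transpose ∘ₗ ρ

/-- `(ρ, α, β, V)` is a representation of the admissible averaging commutative algebra
`(A, m, P, Q)`. -/
def IsRep (m : A →ₗ[K] A →ₗ[K] A) (P Q : A →ₗ[K] A)
    (ρ : A →ₗ[K] V →ₗ[K] V) (α β : V →ₗ[K] V) : Prop :=
  (∀ x y v, ρ (m x y) v = ρ x (ρ y v)) ∧
  (∀ x v, ρ (P x) (α v) = α (ρ (P x) v) ∧ α (ρ (P x) v) = α (ρ x (α v))) ∧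
  (∀ x v, ρ (P x) (β v) = β (ρ (P x) v) ∧ β (ρ (P x) v) = β (ρ x (β v))) ∧
  (∀ x v, ρ (Q x) (α v) = β (ρ x (α v)) ∧ β (ρ x (α v)) = β (ρ (Q x) v))

/-- `(ρ, α, β, V, mV)` is an `(A, m, P, Q)`-representation algebra. -/
def IsRepAlg (m : A →ₗ[K] A →ₗ[K] A) (P Q : A →ₗ[K] A)
    (ρ : A →ₗ[K] V →ₗ[K] V) (α β : V →ₗ[K] V) (mV : V →ₗ[K] V →ₗ[K] V) : Prop :=
  IsRep m P Q ρ α β ∧ IsAdmissibleAveraging mV α β ∧ ∀ x u v, ρ x (mV u v) = mV (ρ x u) v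

/-- The semidirect-product multiplication on `A × V`:
`(x+u)·(y+v) = x·y + ρ(x)v + ρ(y)u + u ·_V v`. -/
def sdMul (m : A →ₗ[K] A →ₗ[K] A) (ρ : A →ₗ[K] V →ₗ[K] V) (mV : V →ₗ[K] V →ₗ[K] V) :
    (A × V) →ₗ[K] (A × V) →ₗ[K] (A × V) :=
  LinearMap.mk₂ K
    (fun p q => (m p.1 q.1, ρ p.1 q.2 + ρ q.1 p.2 + mV p.2 q.2))
    (fun p p' q => by
      simp only [Prod.fst_add, Prod.snd_add, map_add, LinearMap.add_apply, Prod.mk_add_mk,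
        Prod.mk.injEq]
      exact ⟨trivial, by abel⟩)
    (fun c p q => by
      simp only [Prod.smul_fst, Prod.smul_snd, map_smul, LinearMap.smul_apply, Prod.smul_mk,
        smul_add, Prod.mk.injEq])
    (fun p q q' => by
      simp only [Prod.fst_add, Prod.snd_add, map_add, LinearMap.add_apply, Prod.mk_add_mk,
        Prod.mk.injEq]
      exact ⟨trivial, by abel⟩)
    (fun c p q => by
      simp only [Prod.smul_fst, Prod.smul_snd, map_smul, LinearMap.smul_apply, Prod.smul_mk,
        smul_add, Prod.mk.injEq])

/-- Nondegeneracy of a bilinear form. -/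
def IsNondeg (B : A →ₗ[K] A →ₗ[K] K) : Prop := ∀ x, (∀ y, B x y = 0) → x = 0

/-- `(A, m, B)` is a symmetric Frobenius commutative algebra. -/
def IsSymFrob (m : A →ₗ[K] A →ₗ[K] A) (B : A →ₗ[K] A →ₗ[K] K) : Prop :=
  IsComm m ∧ IsAssoc m ∧ (∀ x y, B x y = B y x) ∧ IsNondeg B ∧
    ∀ x y z, B (m x y) z = B x (m y z)

/-- `R` is a Rota–Baxter operator of weight `l` on `(A, m)`. -/
def IsRB (m : A →ₗ[K] A →ₗ[K] A) (R : A →ₗ[K] A) (l : K) : Prop :=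
  ∀ x y, m (R x) (R y) = R (m (R x) y + m x (R y) + l • m x y)

/-- `(A, m, R, B)` is a symmetric Rota–Baxter Frobenius commutative algebra of weight `l`. -/
def IsSymRBFrob (m : A →ₗ[K] A →ₗ[K] A) (R : A →ₗ[K] A) (B : A →ₗ[K] A →ₗ[K] K) (l : K) :
    Prop :=
  IsSymFrob m B ∧ IsRB m R l ∧ ∀ x y, B (R x) y + B x (R y) + l • B x y = 0

/-- `(A, m, P, R, B)` is a symmetric averaging Rota–Baxter Frobenius commutative algebra of
weight `l`. -/
def IsSymAvgRBFrob (m : A →ₗ[K] A →ₗ[K] A) (P R : A →ₗ[K] A) (B : A →ₗ[K] A →ₗ[K] K)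
    (l : K) : Prop :=
  IsSymRBFrob m R B l ∧ IsAveragingOp m P ∧ P ∘ₗ R = R ∘ₗ P

/-- `(A, tr, lt)` is a special apre-perm algebra (with `x ▷ y = tr x y`, `x ◁ y = lt x y`). -/
def IsSAPP (tr lt : A →ₗ[K] A →ₗ[K] A) : Prop :=
  (∀ x y, lt x y = lt y x) ∧
  (∀ x y z, (tr + lt) x ((tr + lt) y z) = (tr + lt) ((tr + lt) x y) z ∧
      (tr + lt) ((tr + lt) x y) z = (tr + lt) ((tr + lt) y x) z) ∧
  (∀ x y z, lt ((tr + lt) x y) z = (tr + lt) x (lt y z) ∧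
      (tr + lt) x (lt y z) = - lt x (lt y z))

/-- `f(x) = id ⊗ R∘(x) + L◁(x) ⊗ id` on `A ⊗ A`. -/
def fmap (tr lt : A →ₗ[K] A →ₗ[K] A) (x : A) : A ⊗[K] A →ₗ[K] A ⊗[K] A :=
  LinearMap.lTensor A ((tr + lt).flip x) + LinearMap.rTensor A (lt x)

/-- `g(x) = L∘(x) ⊗ id − id ⊗ L∘(x)` on `A ⊗ A`. -/
def gmap (tr lt : A →ₗ[K] A →ₗ[K] A) (x : A) : A ⊗[K] A →ₗ[K] A ⊗[K] A :=
  LinearMap.rTensor A ((tr + lt) x) - LinearMap.lTensor A ((tr + lt) x)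

/-- For `r = Σᵢ uᵢ ⊗ vᵢ`, the element
`SA(r) = Σᵢⱼ (uᵢ∘uⱼ)⊗vᵢ⊗vⱼ + uᵢ⊗(vᵢ◁uⱼ)⊗vⱼ + uᵢ⊗uⱼ⊗(vⱼ∘vᵢ)` of `A⊗A⊗A`. -/
def SAcal (tr lt : A →ₗ[K] A →ₗ[K] A) (r : A ⊗[K] A) : A ⊗[K] (A ⊗[K] A) :=
  place1 (liftM (tr + lt)) (r ⊗ₜ[K] r) + place2 (liftM lt) (r ⊗ₜ[K] r) +
    place3 (flipM (tr + lt)) (r ⊗ₜ[K] r)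

/-- `(A, tr, lt, B)` is a quadratic special apre-perm algebra. -/
def IsQuadSAPP (tr lt : A →ₗ[K] A →ₗ[K] A) (B : A →ₗ[K] A →ₗ[K] K) : Prop :=
  IsSAPP tr lt ∧ (∀ x y, B x y = B y x) ∧ IsNondeg B ∧
    ∀ x y z, B (lt x y) z = - B x ((tr + lt) z y)

/-- `(A, tr, lt, R, B)` is a quadratic Rota–Baxter special apre-perm algebra of weight `l`. -/
def IsQuadRBSAPP (tr lt : A →ₗ[K] A →ₗ[K] A) (R : A →ₗ[K] A) (B : A →ₗ[K] A →ₗ[K] K)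
    (l : K) : Prop :=
  IsQuadSAPP tr lt B ∧ IsRB tr R l ∧ IsRB lt R l ∧
    ∀ x y, B (R x) y + B x (R y) + l • B x y = 0

/-- `x ◁ y = −Q(x·y)` as a bilinear map. -/
def ltOf (m : A →ₗ[K] A →ₗ[K] A) (Q : A →ₗ[K] A) : A →ₗ[K] A →ₗ[K] A :=
  - (LinearMap.llcomp K A A A Q ∘ₗ m)

/-- `x ▷ y = P(x)·y + Q(x·y)` as a bilinear map. -/
def trOf (m : A →ₗ[K] A →ₗ[K] A) (P Q : A →ₗ[K] A) : A →ₗ[K] A →ₗ[K] A :=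
  m ∘ₗ P + LinearMap.llcomp K A A A Q ∘ₗ m

/-- The multiplication `a* ◇_s b* = L*(s♯(a*))(b*)` on `A*`. -/
def diamondMap (m : A →ₗ[K] A →ₗ[K] A) (s : A ⊗[K] A) :
    Module.Dual K A →ₗ[K] Module.Dual K A →ₗ[K] Module.Dual K A :=
  dualRep m ∘ₗ sharp s

/-- The natural bilinear form `B_d(x+a*, y+b*) = ⟨a*, y⟩ + ⟨b*, x⟩` on `A × A*`. -/
def pairForm : (A × Module.Dual K A) →ₗ[K] (A × Module.Dual K A) →ₗ[K] K :=
  LinearMap.mk₂ K (fun p q => p.2 q.1 + q.2 p.1)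
    (fun p p' q => by
      simp only [Prod.fst_add, Prod.snd_add, LinearMap.add_apply, map_add]
      ring)
    (fun c p q => by
      simp only [Prod.smul_fst, Prod.smul_snd, LinearMap.smul_apply, map_smul, smul_eq_mul]
      ring)
    (fun p q q' => by
      simp only [Prod.fst_add, Prod.snd_add, LinearMap.add_apply, map_add]
      ring)
    (fun c p q => by
      simp only [Prod.smul_fst, Prod.smul_snd, LinearMap.smul_apply, map_smul, smul_eq_mul]
      ring)

/-- The Zinbiel and admissibility axioms for `(A, ⋆, P, Q)`. -/
def IsAdmAvgZinbiel (st : A →ₗ[K] A →ₗ[K] A) (P Q : A →ₗ[K] A) : Prop :=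
  (∀ x y z, st x (st y z) = st (st x y) z + st (st y x) z) ∧
  (∀ x y, st (P x) (P y) = P (st (P x) y) ∧ P (st (P x) y) = P (st x (P y))) ∧
  (∀ x y, Q (st (P x) y) = st (P x) (Q y) ∧ st (P x) (Q y) = Q (st x (Q y))) ∧
  (∀ x y, Q (st (Q x) y) = st (Q x) (P y) ∧ st (Q x) (P y) = Q (st x (P y)))

end Defs

end Paper

section Theorems

open Paper

variable {K : Type*} [Field K]
variable {A : Type*} [AddCommGroup A] [Module K A]
variable {V : Type*} [AddCommGroup V] [Module K V]

theorem sharp_tmul' {K : Type*} [Field K] {A : Type*} [AddCommGroup A] [Module K A]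
    (u v : A) (a : Module.Dual K A) : sharp (u ⊗ₜ[K] v) a = a u • v := by
  simp [sharp]

theorem sharp_add' {K : Type*} [Field K] {A : Type*} [AddCommGroup A] [Module K A]
    (r s : A ⊗[K] A) (a : Module.Dual K A) : sharp (r + s) a = sharp r a + sharp s a := by
  simp [sharp]

theorem sharp_sub' {K : Type*} [Field K] {A : Type*} [AddCommGroup A] [Module K A]
    (r s : A ⊗[K] A) (a : Module.Dual K A) : sharp (r - s) a = sharp r a - sharp s a := by
  simp [sharp]

theorem sharp_zero' {K : Type*} [Field K] {A : Type*} [AddCommGroup A] [Module K A]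
    (a : Module.Dual K A) : sharp (0 : A ⊗[K] A) a = 0 := by
  simp [sharp]

theorem sharp_lTensor' {K : Type*} [Field K] {A : Type*} [AddCommGroup A] [Module K A]
    (f : A →ₗ[K] A) (r : A ⊗[K] A) (a : Module.Dual K A) :
    sharp (LinearMap.lTensor A f r) a = f (sharp r a) := by
  induction r with
  | zero => simp [sharp_zero']
  | tmul u v => simp [sharp_tmul']
  | add r s hr hs => simp [sharp_add', hr, hs]

theorem sharp_rTensor' {K : Type*} [Field K] {A : Type*} [AddCommGroup A] [Module K A]
    (f : A →ₗ[K] A) (r : A ⊗[K] A) (a : Module.Dual K A) :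
    sharp (LinearMap.rTensor A f r) a = sharp r (a ∘ₗ f) := by
  induction r with
  | zero => simp [sharp_zero']
  | tmul u v => simp [sharp_tmul']
  | add r s hr hs => simp [sharp_add', hr, hs]

theorem sharp_comm' {K : Type*} [Field K] {A : Type*} [AddCommGroup A] [Module K A]
    (r : A ⊗[K] A) (a b : Module.Dual K A) :
    b (sharp (TensorProduct.comm K A A r) a) = a (sharp r b) := by
  induction r with
  | zero => simp [sharp_zero']
  | tmul u v => simp [sharp_tmul', mul_comm]
  | add r s hr hs => simp [sharp_add', hr, hs]

theorem sharp_inj' {K : Type*} [Field K] {A : Type*} [AddCommGroup A] [Module K A]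
    [FiniteDimensional K A] (r : A ⊗[K] A) (h : ∀ a, sharp r a = 0) : r = 0 := by
  let b := Module.finBasis K A
  have key : ∀ (r : A ⊗[K] A) i j,
      (b.tensorProduct b).repr r (i, j) = b.coord j (sharp r (b.coord i)) := by
    intro r i j
    induction r with
    | zero => simp [sharp_zero']
    | tmul u v => simp [sharp_tmul', mul_comm]
    | add r s hr hs => simp only [sharp_add', map_add, Finsupp.add_apply, hr, hs]
  apply (b.tensorProduct b).repr.injective
  ext ⟨i, j⟩
  rw [key, h]
  simp

theorem quadratic_sapp_iff_invariant_tensor [FiniteDimensional K A]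
    (tr lt : A →ₗ[K] A →ₗ[K] A) (hsapp : IsSAPP tr lt)
    (B : A →ₗ[K] A →ₗ[K] K) (hnd : IsNondeg B)
    (φ : A ⊗[K] A) (hφ : ∀ x, sharp φ (B x) = x) :
    (((∀ x y, B x y = B y x) ∧ ∀ x y z, B (lt x y) z = - B x ((tr + lt) z y)) ↔
      (TensorProduct.comm K A A φ = φ ∧ ∀ x : A, fmap tr lt x φ = 0)) ∧
    (((∀ x y, B x y = B y x) ∧ ∀ x y z, B (lt x y) z = - B x ((tr + lt) z y)) →
      ∀ x : A, gmap tr lt x φ = 0) := by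
  have hc := hsapp.1
  have hinj : Function.Injective B := by
    intro x y hxy
    rw [← hφ x, hxy, hφ]
  have hsurj : Function.Surjective B :=
    (LinearMap.injective_iff_surjective_of_finrank_eq_finrank
      (Subspace.dual_finrank_eq (K := K) (V := A)).symm).1 hinj
  have hB : ∀ a : Module.Dual K A, B (sharp φ a) = a := by
    intro a
    obtain ⟨x, rfl⟩ := hsurj a
    rw [hφ]
  have hsep : ∀ r : A ⊗[K] A, r = 0 ↔ ∀ y z, B (sharp r (B y)) z = 0 := by
    intro r
    constructor
    · rintro rfl y z
      simp [sharp_zero']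
    · intro h
      apply sharp_inj'
      intro a
      obtain ⟨y, rfl⟩ := hsurj a
      exact hnd _ (h y)
  have hf : ∀ x, fmap tr lt x φ = 0 ↔ ∀ y z, B ((tr + lt) y x) z + B y (lt x z) = 0 := by
    intro x
    rw [hsep]
    simp only [fmap, LinearMap.add_apply (LinearMap.lTensor A _), sharp_add', sharp_lTensor',
      sharp_rTensor', hφ, map_add B, hB, LinearMap.add_apply (B _), LinearMap.comp_apply,
      LinearMap.flip_apply]
  have hg : ∀ x, gmap tr lt x φ = 0 ↔ ∀ y z, B y ((tr + lt) x z) - B ((tr + lt) x y) z = 0 := by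
    intro x
    rw [hsep]
    simp only [gmap, LinearMap.sub_apply, sharp_sub', sharp_lTensor',
      sharp_rTensor', hφ, map_sub, hB, LinearMap.comp_apply]
  have hs : TensorProduct.comm K A A φ = φ ↔ ∀ x y, B x y = B y x := by
    constructor
    · intro h x y
      have := sharp_comm' φ (B x) (B y)
      rw [h, hφ, hφ] at this
      exact this.symm
    · intro h
      rw [← sub_eq_zero, hsep]
      intro y z
      rw [sharp_sub', hφ, map_sub, LinearMap.sub_apply, h _ z, sharp_comm', hφ, sub_self]
  refine ⟨?_, ?_⟩
  · rw [hs]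
    refine and_congr_right fun hsym => ?_
    simp only [hf]
    constructor
    · intro h x y z
      have h1 := h z x y
      rw [hsym _ y, hc z x] at h1
      rw [hsym _ z]
      linear_combination h1
    · intro h x y z
      have h1 := h y z x
      rw [hsym _ x, hsym z, hc y x] at h1
      linear_combination h1
  · rintro ⟨hsym, h⟩ x
    rw [hg]
    intro y z
    have h1 := h y z x
    have h2 := h z y x
    rw [hc z y] at h2
    rw [hsym _ z]
    linear_combination h1 - h2

end Theorems
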